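/- arXiv:1311.3745 — 2 statements merged into one kernel-verified Lean document; each statement's English description precedes it below -/
import Mathlib

section
/- Let k be a field, X a finitely generated free abelian group, A = k[X] the group algebra of X over k (with basis {e^x : x ∈ X}), and α ∈ X, α̌ ∈ Hom(X,ℤ) with ⟨α,α̌⟩ = 2; let s_α be the k-algebra automorphism of A given by e^x ↦ e^{x − ⟨x,α̌⟩α}, and D_α : A → A the unique map with (1 − e^{−α})·D_α(f) = f − s_α(f) for all f ∈ A. Let V be a finite-dimensional k-vector space, ρ : A → End_k(V) a k-algebra homomorphism, c ∈ k, and T ∈ End_k(V) an operator satisfying T∘ρ(f) − ρ(s_α(f))∘T = c·ρ(D_α(f)) for all f ∈ A. Let λ : A → k be a k-algebra homomorphism. Then: (i) if λ∘s_α = λ, then T maps the generalized weight space V_λ into itself; (ii) if λ∘s_α ≠ λ, then λ(1 − e^{−α}) ≠ 0, T maps V_λ into V_λ + V_{λ∘s_α}, and for every v ∈ V_λ one may write Tv = w + u with w ∈ V_λ, u ∈ V_{λ∘s_α}, and ρ(1 − e^{−α})(w) = c·v. -/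
/-- The generalized weight space of a weight `lam : A → k` in a representation
`ρ : A → End_k(V)`. -/
def genWt {k V A : Type*} [Field k] [AddCommGroup V] [Module k V]
    [CommRing A] [Algebra k A]
    (ρ : A →ₐ[k] Module.End k V) (lam : A →ₐ[k] k) : Set V :=
  {v | ∀ f : A, ∃ m : ℕ, ((ρ f - lam f • (1 : Module.End k V)) ^ m) v = 0}

section Helpers

variable {k V A : Type*} [Field k] [AddCommGroup V] [Module k V] [CommRing A] [Algebra k A]

theorem genWt_iff (ρ : A →ₐ[k] Module.End k V) (lam : A →ₐ[k] k) (v : V) :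
    v ∈ genWt ρ lam ↔ ∀ f : A, lam f = 0 → ∃ m : ℕ, ρ (f ^ m) v = 0 := by
  constructor
  · intro h f hf
    obtain ⟨m, hm⟩ := h f
    refine ⟨m, ?_⟩
    rw [hf, zero_smul, sub_zero, ← map_pow] at hm
    exact hm
  · intro h f
    obtain ⟨m, hm⟩ := h (f - algebraMap k A (lam f)) (by simp)
    refine ⟨m, ?_⟩
    rw [map_pow, map_sub, AlgHom.commutes, Algebra.algebraMap_eq_smul_one] at hm
    exact hm

theorem rho_pow_zero (ρ : A →ₐ[k] Module.End k V) (f : A) (v : V) (a b : ℕ)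
    (h : ρ (f ^ a) v = 0) : ρ (f ^ (b + a)) v = 0 := by
  rw [pow_add, map_mul, Module.End.mul_apply, h, map_zero]

theorem genWt_sub (ρ : A →ₐ[k] Module.End k V) (lam : A →ₐ[k] k) {v w : V}
    (hv : v ∈ genWt ρ lam) (hw : w ∈ genWt ρ lam) : v - w ∈ genWt ρ lam := by
  rw [genWt_iff] at *
  intro f hf
  obtain ⟨a, ha⟩ := hv f hf
  obtain ⟨b, hb⟩ := hw f hf
  refine ⟨a + b, ?_⟩
  rw [map_sub, rho_pow_zero ρ f w b a hb, add_comm, rho_pow_zero ρ f v a b ha, sub_zero]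

theorem genWt_smul (ρ : A →ₐ[k] Module.End k V) (lam : A →ₐ[k] k) {v : V} (c : k)
    (hv : v ∈ genWt ρ lam) : c • v ∈ genWt ρ lam := by
  rw [genWt_iff] at *
  intro f hf
  obtain ⟨a, ha⟩ := hv f hf
  exact ⟨a, by rw [map_smul, ha, smul_zero]⟩

theorem rho_comm (ρ : A →ₐ[k] Module.End k V) (f g : A) (v : V) :
    ρ f (ρ g v) = ρ g (ρ f v) := by
  rw [← Module.End.mul_apply, ← map_mul, mul_comm, map_mul, Module.End.mul_apply]

theorem genWt_rho (ρ : A →ₐ[k] Module.End k V) (lam : A →ₐ[k] k) {v : V} (g : A)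
    (hv : v ∈ genWt ρ lam) : ρ g v ∈ genWt ρ lam := by
  rw [genWt_iff] at *
  intro f hf
  obtain ⟨a, ha⟩ := hv f hf
  exact ⟨a, by rw [rho_comm, ha, map_zero]⟩

theorem part_one (s : A ≃ₐ[k] A) (hss : ∀ f, s (s f) = f) (D : A → A)
    (ρ : A →ₐ[k] Module.End k V) (c : k) (T : Module.End k V)
    (hT : ∀ f v, ρ (s f) (T v) = T (ρ f v) - c • ρ (D f) v)
    (lam : A →ₐ[k] k) (hl : ∀ f, lam (s f) = lam f) (v : V) (hv : v ∈ genWt ρ lam) :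
    T v ∈ genWt ρ lam := by
  rw [genWt_iff]
  intro p hp
  have key : ∀ m : ℕ, T (ρ ((s p) ^ m) v) - ρ (p ^ m) (T v) ∈ genWt ρ lam := by
    intro m
    induction m with
    | zero =>
      have h0 := genWt_smul ρ lam 0 hv
      simpa using h0
    | succ m ih =>
      have h1 := genWt_rho ρ lam p ih
      have h2 := genWt_smul ρ lam (-c)
        (genWt_rho ρ lam (D (s p)) (genWt_rho ρ lam ((s p) ^ m) hv))
      have h3 := genWt_sub ρ lam h1 h2
      have h4 := hT (s p) (ρ ((s p) ^ m) v)
      rw [hss] at h4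
      rw [map_sub, h4] at h3
      simp only [pow_succ', map_mul, Module.End.mul_apply] at *
      convert h3 using 1
      module
  obtain ⟨N, hN⟩ := (genWt_iff ρ lam v).1 hv (s p) (by rw [hl, hp])
  have h := key N
  rw [hN, map_zero, genWt_iff] at h
  obtain ⟨M, hM⟩ := h p hp
  refine ⟨M + N, ?_⟩
  rw [zero_sub, map_neg, neg_eq_zero] at hM
  rw [pow_add, map_mul, Module.End.mul_apply, hM]

theorem part_two (s : A ≃ₐ[k] A) (hss : ∀ f, s (s f) = f) (D : A → A) (d : A)
    (hD : ∀ f, d * D f = f - s f)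
    (ρ : A →ₐ[k] Module.End k V) (c : k) (T : Module.End k V)
    (hT : ∀ f v, ρ (s f) (T v) = T (ρ f v) - c • ρ (D f) v)
    (lam : A →ₐ[k] k) (hd : lam d ≠ 0) (v : V) (hv : v ∈ genWt ρ lam) :
    ∃ w ∈ genWt ρ lam, ∃ u ∈ genWt ρ (lam.comp s.toAlgHom),
          T v = w + u ∧ ρ d w = c • v := by
  obtain ⟨m, hm⟩ := (genWt_iff ρ lam v).1 hv (d - algebraMap k A (lam d)) (by simp)
  have hco : IsCoprime d ((d - algebraMap k A (lam d)) ^ m) := by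
    apply IsCoprime.pow_right
    refine ⟨algebraMap k A (lam d)⁻¹, - algebraMap k A (lam d)⁻¹, ?_⟩
    have : algebraMap k A (lam d)⁻¹ * algebraMap k A (lam d) = 1 := by
      rw [← map_mul, inv_mul_cancel₀ hd, map_one]
    linear_combination this
  obtain ⟨h, r, hhr⟩ := hco
  have hdv : ρ d (ρ h v) = v := by
    have := congrArg (fun f => ρ f v) hhr
    simp only [map_add, map_mul, map_one, LinearMap.add_apply, Module.End.mul_apply,
      Module.End.one_apply] at this
    rw [map_pow] at hm
    rw [map_pow, hm, map_zero, add_zero, rho_comm] at this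
    exact this
  refine ⟨c • ρ h v, genWt_smul ρ lam c (genWt_rho ρ lam h hv), T v - c • ρ h v, ?_, by abel, ?_⟩
  · rw [genWt_iff]
    intro p hp
    have hp' : lam (s p) = 0 := hp
    have step : ∀ v', ρ d (ρ h v') = v' →
        ρ p (T v' - c • ρ h v') = T (ρ (s p) v') - c • ρ h (ρ (s p) v') := by
      intro v' hv'
      have h4 := hT (s p) v'
      rw [hss] at h4
      have h5 : ρ (D (s p)) v' = ρ h (ρ (s p) v') - ρ h (ρ p v') := by
        have h6 := congrArg (fun f => ρ f (ρ h v')) (hD (s p))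
        simp only [hss, map_sub, map_mul, LinearMap.sub_apply, Module.End.mul_apply] at h6
        rw [rho_comm ρ d, hv', rho_comm ρ (s p), rho_comm ρ p] at h6
        exact h6
      rw [map_sub, map_smul, h4, h5, rho_comm ρ p h]
      module
    have key : ∀ m : ℕ, ρ (p ^ m) (T v - c • ρ h v) =
        T (ρ ((s p) ^ m) v) - c • ρ h (ρ ((s p) ^ m) v) := by
      intro m
      induction m with
      | zero => simp
      | succ m ih =>
        rw [pow_succ', map_mul, Module.End.mul_apply, ih, step, pow_succ', map_mul,
          Module.End.mul_apply]
        rw [rho_comm ρ h, rho_comm ρ d, hdv]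
    obtain ⟨N, hN⟩ := (genWt_iff ρ lam v).1 hv (s p) hp'
    exact ⟨N, by rw [key, hN]; simp⟩
  · rw [map_smul, hdv]

end Helpers

/-- Let `A = k[X]` be the group algebra of a finitely generated free
abelian group `X`, `α ∈ X`, `α̌ ∈ Hom(X,ℤ)` with `⟨α,α̌⟩ = 2`, `s_α` the algebra automorphism
`e^x ↦ e^{x−⟨x,α̌⟩α}`, and `D_α` the unique operator with `(1 − e^{−α})·D_α(f) = f − s_α(f)`.
If `T` is an operator on a finite dimensional representation `(V,ρ)` of `A` satisfying
`T∘ρ(f) − ρ(s_α f)∘T = c·ρ(D_α f)`, then: (i) if `λ∘s_α = λ`, `T` preserves `V_λ`; (ii) if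
`λ∘s_α ≠ λ`, then `λ(1−e^{−α}) ≠ 0` and every `v ∈ V_λ` has `Tv = w + u` with `w ∈ V_λ`,
`u ∈ V_{λ∘s_α}` and `ρ(1−e^{−α})(w) = c·v`. -/
theorem demazure_commutation_weight_spaces
    {k : Type*} [Field k] (n : ℕ)
    (α : Fin n → ℤ) (acheck : (Fin n → ℤ) →+ ℤ) (h2 : acheck α = 2)
    (s : AddMonoidAlgebra k (Fin n → ℤ) ≃ₐ[k] AddMonoidAlgebra k (Fin n → ℤ))
    (hs : ∀ x : Fin n → ℤ, s (AddMonoidAlgebra.single x 1) =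
        AddMonoidAlgebra.single (x - acheck x • α) 1)
    (Dem : AddMonoidAlgebra k (Fin n → ℤ) → AddMonoidAlgebra k (Fin n → ℤ))
    (hDem : ∀ f, (1 - AddMonoidAlgebra.single (-α) (1 : k)) * Dem f = f - s f)
    {V : Type*} [AddCommGroup V] [Module k V] [FiniteDimensional k V]
    (ρ : AddMonoidAlgebra k (Fin n → ℤ) →ₐ[k] Module.End k V)
    (c : k) (T : Module.End k V)
    (hT : ∀ f, T * ρ f - ρ (s f) * T = c • ρ (Dem f))
    (lam : AddMonoidAlgebra k (Fin n → ℤ) →ₐ[k] k) :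
    (lam.comp s.toAlgHom = lam → ∀ v ∈ genWt ρ lam, T v ∈ genWt ρ lam) ∧
    (lam.comp s.toAlgHom ≠ lam →
      lam (1 - AddMonoidAlgebra.single (-α) (1 : k)) ≠ 0 ∧
      ∀ v ∈ genWt ρ lam,
        ∃ w ∈ genWt ρ lam, ∃ u ∈ genWt ρ (lam.comp s.toAlgHom),
          T v = w + u ∧ ρ (1 - AddMonoidAlgebra.single (-α) (1 : k)) w = c • v) := by
  have hT' : ∀ f v, ρ (s f) (T v) = T (ρ f v) - c • ρ (Dem f) v := by
    intro f v
    have := congrArg (fun F : Module.End k V => F v) (hT f)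
    simp only [LinearMap.sub_apply, Module.End.mul_apply, LinearMap.smul_apply] at this
    rw [← this]
    abel
  have hss : ∀ f, s (s f) = f := by
    have : (s.toAlgHom.comp s.toAlgHom) = AlgHom.id k _ := by
      refine AddMonoidAlgebra.algHom_ext ?_ (Subsingleton.elim _ _)
      intro x
      change s (s (AddMonoidAlgebra.single x 1)) = AddMonoidAlgebra.single x 1
      rw [hs, hs]
      congr 1
      rw [map_sub, map_zsmul, h2]
      simp only [smul_eq_mul]
      module
    intro f
    exact congrArg (fun F => F f) this
  refine ⟨fun hl v hv => part_one s hss Dem ρ c T hT' lam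
    (fun f => congrArg (fun F => F f) hl) v hv, fun hne => ?_⟩
  have hd : lam (1 - AddMonoidAlgebra.single (-α) (1 : k)) ≠ 0 := by
    intro h0
    apply hne
    rw [map_sub, map_one, sub_eq_zero] at h0
    let φ : Multiplicative (Fin n → ℤ) →* k :=
      (lam : AddMonoidAlgebra k (Fin n → ℤ) →* k).comp (AddMonoidAlgebra.of k (Fin n → ℤ))
    have hφ : ∀ x, φ (Multiplicative.ofAdd x) = lam (AddMonoidAlgebra.single x 1) :=
      fun x => rfl
    have hinv : φ.toHomUnits (Multiplicative.ofAdd (-α)) = 1 := by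
      ext
      rw [MonoidHom.coe_toHomUnits, hφ, ← h0, Units.val_one]
    refine AddMonoidAlgebra.algHom_ext ?_ (Subsingleton.elim _ _)
    intro x
    change lam (s (AddMonoidAlgebra.single x 1)) = lam (AddMonoidAlgebra.single x 1)
    rw [hs, ← hφ, ← hφ]
    have : x - acheck x • α = x + acheck x • (-α) := by module
    rw [this, ofAdd_add, ofAdd_zsmul, ← MonoidHom.coe_toHomUnits, map_mul, map_zpow, hinv,
      one_zpow, mul_one, MonoidHom.coe_toHomUnits]
  exact ⟨hd, fun v hv => part_two s hss Dem _ hDem ρ c T hT' lam hd v hv⟩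
end

section
/- Let X be a finitely generated free abelian group and let A^h be the commutative ℤ[h]-algebra presented by generators {P_x : x ∈ X} and relations P_0 = 0 and P_x + P_y + h·P_x·P_y = P_{x+y} for all x, y ∈ X. Then the unique ℤ[h]-algebra homomorphism φ from A^h to the group algebra ℤ[h,h^{−1}][X] of X over Laurent polynomials, determined by φ(P_x) = h^{−1}(e^x − 1), is injective; hence A^h is isomorphic to the ℤ[h]-subalgebra of ℤ[h,h^{−1}][X] generated by the elements h^{−1}(e^x − 1) for x ∈ X. -/
open scoped BigOperators

noncomputable section

/-- The defining ideal of the interpolating algebra `A^h`: the relations `P_0 = 0` and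
`P_x + P_y + h·P_x·P_y = P_{x+y}` inside the polynomial ring over `ℤ[h]` on indeterminates
`{P_x : x ∈ X}`. -/
def interpIdeal (X : Type*) [AddCommGroup X] : Ideal (MvPolynomial X (Polynomial ℤ)) :=
  Ideal.span ({MvPolynomial.X (0 : X)} ∪
    Set.range fun p : X × X =>
      MvPolynomial.X p.1 + MvPolynomial.X p.2 +
        MvPolynomial.C Polynomial.X * MvPolynomial.X p.1 * MvPolynomial.X p.2 -
        MvPolynomial.X (p.1 + p.2))

/-- The interpolating algebra `A^h` presented by generators `{P_x : x ∈ X}` over `ℤ[h]` with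
relations `P_0 = 0`, `P_x + P_y + h·P_x·P_y = P_{x+y}`. -/
def InterpAlg (X : Type*) [AddCommGroup X] : Type _ :=
  MvPolynomial X (Polynomial ℤ) ⧸ interpIdeal X

instance (X : Type*) [AddCommGroup X] : CommRing (InterpAlg X) :=
  inferInstanceAs (CommRing (MvPolynomial X (Polynomial ℤ) ⧸ interpIdeal X))

instance (X : Type*) [AddCommGroup X] : Algebra (Polynomial ℤ) (InterpAlg X) :=
  inferInstanceAs (Algebra (Polynomial ℤ) (MvPolynomial X (Polynomial ℤ) ⧸ interpIdeal X))

/-- The generator `P_x` of `A^h`. -/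
def InterpAlg.P {X : Type*} [AddCommGroup X] (x : X) : InterpAlg X :=
  Ideal.Quotient.mk (interpIdeal X) (MvPolynomial.X x)

/-- The group algebra of `X` over the Laurent polynomial ring `ℤ[h,h⁻¹]`, as a
`ℤ[h]`-algebra. -/
instance laurentGroupAlgebra (X : Type*) [AddCommGroup X] :
    Algebra (Polynomial ℤ) (AddMonoidAlgebra (LaurentPolynomial ℤ) X) :=
  RingHom.toAlgebra
    ((algebraMap (LaurentPolynomial ℤ) (AddMonoidAlgebra (LaurentPolynomial ℤ) X)).comp
      Polynomial.toLaurent)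

namespace InterpAlg

variable {X : Type*} [AddCommGroup X]

abbrev Grp (X : Type*) [AddCommGroup X] := AddMonoidAlgebra (LaurentPolynomial ℤ) X

/-- The element `h⁻¹(e^x − 1)`. -/
def q (x : X) : Grp X :=
  algebraMap (LaurentPolynomial ℤ) (AddMonoidAlgebra (LaurentPolynomial ℤ) X)
    (LaurentPolynomial.T (-1)) * (AddMonoidAlgebra.single x 1 - 1)

/-- The element `h` of `A^h`. -/
def hh (X : Type*) [AddCommGroup X] : InterpAlg X :=
  algebraMap (Polynomial ℤ) (InterpAlg X) Polynomial.X

theorem P_zero : P (0 : X) = 0 :=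
  Ideal.Quotient.eq_zero_iff_mem.mpr (Ideal.subset_span (Or.inl rfl))

theorem P_add (x y : X) : P (x + y) = P x + P y + hh X * P x * P y := by
  symm
  exact Ideal.Quotient.eq.mpr (Ideal.subset_span (Or.inr ⟨(x, y), rfl⟩))

theorem T_mul : (algebraMap (LaurentPolynomial ℤ) (Grp X) (LaurentPolynomial.T 1)) *
    algebraMap (LaurentPolynomial ℤ) (Grp X) (LaurentPolynomial.T (-1)) = 1 := by
  rw [← map_mul, ← LaurentPolynomial.T_add, add_neg_cancel, LaurentPolynomial.T_zero, map_one]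

theorem algebraMap_X : algebraMap (Polynomial ℤ) (Grp X) Polynomial.X =
    algebraMap (LaurentPolynomial ℤ) (Grp X) (LaurentPolynomial.T 1) := by
  change algebraMap (LaurentPolynomial ℤ) (Grp X) (Polynomial.toLaurent Polynomial.X) = _
  rw [Polynomial.toLaurent_X]

theorem q_add (x y : X) : q x + q y +
    algebraMap (Polynomial ℤ) (Grp X) Polynomial.X * q x * q y = q (x + y) := by
  have h : (AddMonoidAlgebra.single (x + y) 1 : Grp X) =
      AddMonoidAlgebra.single x 1 * AddMonoidAlgebra.single y 1 := by
    rw [AddMonoidAlgebra.single_mul_single, one_mul]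
  unfold q
  rw [h, algebraMap_X]
  linear_combination (algebraMap (LaurentPolynomial ℤ) (Grp X) (LaurentPolynomial.T (-1)) *
    (AddMonoidAlgebra.single x 1 - 1) * (AddMonoidAlgebra.single y 1 - 1)) * T_mul (X := X)

theorem q_zero : q (0 : X) = 0 := by
  unfold q
  rw [← AddMonoidAlgebra.one_def, sub_self, mul_zero]

theorem ideal_le : ∀ a ∈ interpIdeal X,
    (MvPolynomial.aeval (R := Polynomial ℤ) (q (X := X))) a = 0 := by
  intro a ha
  have : interpIdeal X ≤
      RingHom.ker (MvPolynomial.aeval (R := Polynomial ℤ) (q (X := X))).toRingHom := by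
    unfold interpIdeal
    rw [Ideal.span_le]
    rintro _ (rfl | ⟨⟨x, y⟩, rfl⟩)
    · simp [RingHom.mem_ker, q_zero]
    · have := q_add x y
      simp only [SetLike.mem_coe, RingHom.mem_ker, AlgHom.toRingHom_eq_coe, RingHom.coe_coe,
        map_sub, map_add, map_mul, MvPolynomial.aeval_X, MvPolynomial.aeval_C]
      rw [this, sub_self]
  exact this ha

/-- The homomorphism `φ`. -/
def phi (X : Type*) [AddCommGroup X] : InterpAlg X →ₐ[Polynomial ℤ] Grp X :=
  Ideal.Quotient.liftₐ (interpIdeal X) (MvPolynomial.aeval (R := Polynomial ℤ) q) ideal_le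

theorem phi_P (x : X) : phi X (P x) = q x := by
  have : phi X (P x) = MvPolynomial.aeval (R := Polynomial ℤ) q (MvPolynomial.X x) := rfl
  rw [this, MvPolynomial.aeval_X]

theorem hom_ext {B : Type*} [CommRing B] [Algebra (Polynomial ℤ) B]
    (f g : InterpAlg X →ₐ[Polynomial ℤ] B) (h : ∀ x, f (P x) = g (P x)) : f = g := by
  refine Ideal.Quotient.algHom_ext (R₁ := Polynomial ℤ) (I := interpIdeal X) (f := f) (g := g) ?_
  exact MvPolynomial.algHom_ext h

theorem adjoin_P : Algebra.adjoin (Polynomial ℤ) (Set.range (P (X := X))) = ⊤ := by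
  rw [eq_top_iff]
  intro a _
  obtain ⟨p, rfl⟩ := Ideal.Quotient.mk_surjective (I := interpIdeal X) a
  let m : MvPolynomial X (Polynomial ℤ) →ₐ[Polynomial ℤ] InterpAlg X :=
    Ideal.Quotient.mkₐ (Polynomial ℤ) (interpIdeal X)
  have : m = MvPolynomial.aeval (P (X := X)) := MvPolynomial.algHom_ext fun x => by
    rw [MvPolynomial.aeval_X]; rfl
  change m p ∈ _
  rw [this, Algebra.adjoin_range_eq_range_aeval]
  exact ⟨p, rfl⟩

variable {ι : Type*} (b : Module.Basis ι ℤ X)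

/-- The map from the polynomial ring on a basis. -/
def g : MvPolynomial ι (Polynomial ℤ) →ₐ[Polynomial ℤ] InterpAlg X :=
  MvPolynomial.aeval (fun i => P (b i))

theorem P_mem {x : X} (hx : x ∈ AddSubmonoid.closure (Set.range b)) : P x ∈ (g b).range := by
  induction hx using AddSubmonoid.closure_induction with
  | mem x hx =>
    obtain ⟨i, rfl⟩ := hx
    exact ⟨MvPolynomial.X i, MvPolynomial.aeval_X _ _⟩
  | zero => rw [P_zero]; exact zero_mem _
  | add x y _ _ h1 h2 =>
    rw [P_add]
    exact add_mem (add_mem h1 h2) (mul_mem (mul_mem (Subalgebra.algebraMap_mem _ _) h1) h2)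

theorem exists_cone (x : X) : ∃ y ∈ AddSubmonoid.closure (Set.range b),
    x + y ∈ AddSubmonoid.closure (Set.range b) := by
  have hx : x ∈ AddSubgroup.closure (Set.range b) := by
    have := b.mem_span x
    rw [← Submodule.mem_toAddSubgroup, Submodule.span_int_eq_addSubgroupClosure] at this
    exact this
  induction hx using AddSubgroup.closure_induction with
  | mem x hx =>
    exact ⟨0, zero_mem _, by rw [add_zero]; exact AddSubmonoid.subset_closure hx⟩
  | zero => exact ⟨0, zero_mem _, by rw [add_zero]; exact zero_mem _⟩
  | add x y _ _ h1 h2 =>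
    obtain ⟨u, hu, hu'⟩ := h1
    obtain ⟨v, hv, hv'⟩ := h2
    exact ⟨u + v, add_mem hu hv, by rw [add_add_add_comm]; exact add_mem hu' hv'⟩
  | neg x _ h =>
    obtain ⟨u, hu, hu'⟩ := h
    exact ⟨x + u, hu', by rwa [neg_add_cancel_left]⟩

theorem u_add (x y : X) :
    1 + hh X * P (x + y) = (1 + hh X * P x) * (1 + hh X * P y) := by
  rw [P_add]; ring

theorem u_mem {x : X} (hx : x ∈ AddSubmonoid.closure (Set.range b)) :
    1 + hh X * P x ∈ (g b).range :=
  add_mem (one_mem _) (mul_mem (Subalgebra.algebraMap_mem _ _) (P_mem b hx))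

theorem exists_mul (a : InterpAlg X) : ∃ x ∈ AddSubmonoid.closure (Set.range b),
    (1 + hh X * P x) * a ∈ (g b).range := by
  have ha : a ∈ Algebra.adjoin (Polynomial ℤ) (Set.range (P (X := X))) := by
    rw [adjoin_P]; trivial
  induction ha using Algebra.adjoin_induction with
  | mem a ha =>
    obtain ⟨x, rfl⟩ := ha
    obtain ⟨y, hy, hxy⟩ := exists_cone b x
    refine ⟨y, hy, ?_⟩
    have : (1 + hh X * P y) * P x = P (x + y) - P y := by rw [P_add]; ring
    rw [this]
    exact sub_mem (P_mem b hxy) (P_mem b hy)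
  | algebraMap r =>
    exact ⟨0, zero_mem _, mul_mem (u_mem b (zero_mem _)) (Subalgebra.algebraMap_mem _ _)⟩
  | add a c _ _ h1 h2 =>
    obtain ⟨x, hx, hx'⟩ := h1
    obtain ⟨y, hy, hy'⟩ := h2
    refine ⟨x + y, add_mem hx hy, ?_⟩
    have : (1 + hh X * P (x + y)) * (a + c) = (1 + hh X * P y) * ((1 + hh X * P x) * a) +
        (1 + hh X * P x) * ((1 + hh X * P y) * c) := by rw [u_add]; ring
    rw [this]
    exact add_mem (mul_mem (u_mem b hy) hx') (mul_mem (u_mem b hx) hy')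
  | mul a c _ _ h1 h2 =>
    obtain ⟨x, hx, hx'⟩ := h1
    obtain ⟨y, hy, hy'⟩ := h2
    refine ⟨x + y, add_mem hx hy, ?_⟩
    have : (1 + hh X * P (x + y)) * (a * c) = ((1 + hh X * P x) * a) *
        ((1 + hh X * P y) * c) := by rw [u_add]; ring
    rw [this]
    exact mul_mem hx' hy'

/-- The substitution `t_i ↦ h⁻¹ (t_i - 1)`. -/
def sig (ι : Type*) : MvPolynomial ι (LaurentPolynomial ℤ) →ₐ[LaurentPolynomial ℤ]
    MvPolynomial ι (LaurentPolynomial ℤ) :=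
  MvPolynomial.aeval fun i => MvPolynomial.C (LaurentPolynomial.T (-1)) * (MvPolynomial.X i - 1)

/-- The substitution `t_i ↦ h t_i + 1`. -/
def tau (ι : Type*) : MvPolynomial ι (LaurentPolynomial ℤ) →ₐ[LaurentPolynomial ℤ]
    MvPolynomial ι (LaurentPolynomial ℤ) :=
  MvPolynomial.aeval fun i => MvPolynomial.C (LaurentPolynomial.T 1) * MvPolynomial.X i + 1

theorem sig_injective : Function.Injective (sig ι) := by
  have h : (tau ι).comp (sig ι) = AlgHom.id _ _ := by
    apply MvPolynomial.algHom_ext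
    intro i
    have : (MvPolynomial.C (LaurentPolynomial.T (-1)) * MvPolynomial.C (LaurentPolynomial.T 1) :
      MvPolynomial ι (LaurentPolynomial ℤ)) = 1 := by
      rw [← map_mul, ← LaurentPolynomial.T_add]; simp
    simp only [AlgHom.comp_apply, sig, tau, MvPolynomial.aeval_X, map_mul, map_sub, map_one,
      MvPolynomial.algHom_C, MvPolynomial.algebraMap_eq, add_sub_cancel_right, ← mul_assoc, this,
      one_mul, AlgHom.id_apply]
  intro x y hxy
  have := congrArg (tau ι) hxy
  rw [← AlgHom.comp_apply, ← AlgHom.comp_apply, h] at this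
  exact this

/-- The evaluation `t_i ↦ e^{b_i}`. -/
def ev : MvPolynomial ι (LaurentPolynomial ℤ) →ₐ[LaurentPolynomial ℤ] Grp X :=
  MvPolynomial.aeval fun i => AddMonoidAlgebra.single (b i) 1

/-- The exponent map. -/
def ex : (ι →₀ ℕ) →+ X :=
  (b.repr.symm.toAddEquiv.toAddMonoidHom).comp (Finsupp.mapRange.addMonoidHom (Nat.castAddMonoidHom ℤ))

theorem ex_injective : Function.Injective (ex b) := by
  refine b.repr.symm.injective.comp ?_
  exact Finsupp.mapRange_injective _ (map_zero (Nat.castAddMonoidHom ℤ)) Nat.cast_injective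

theorem ev_injective : Function.Injective (ev b) := by
  have h : ev b = AddMonoidAlgebra.mapDomainAlgHom (LaurentPolynomial ℤ) (LaurentPolynomial ℤ)
      (ex b) := by
    apply MvPolynomial.algHom_ext
    intro i
    rw [ev, MvPolynomial.aeval_X]
    have : (MvPolynomial.X i : MvPolynomial ι (LaurentPolynomial ℤ)) =
      AddMonoidAlgebra.single (Finsupp.single i 1) 1 := rfl
    rw [this]
    simp [ex]
  rw [h]
  exact AddMonoidAlgebra.mapDomain_injective (ex_injective b)

theorem comp_injective : Function.Injective ((phi X).comp (g b)) := by
  have h : ∀ p, (phi X).comp (g b) p = ev b (sig ι (MvPolynomial.map Polynomial.toLaurent p)) := by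
    intro p
    induction p using MvPolynomial.induction_on with
    | C r =>
      rw [MvPolynomial.algHom_C, MvPolynomial.map_C, MvPolynomial.algHom_C,
        MvPolynomial.algebraMap_eq, MvPolynomial.algHom_C]
      rfl
    | add p q hp hq => simp only [map_add, hp, hq]
    | mul_X p i hp =>
      rw [map_mul, map_mul, map_mul, map_mul, hp]
      congr 1
      rw [AlgHom.comp_apply, g, MvPolynomial.aeval_X, phi_P, MvPolynomial.map_X, sig,
        MvPolynomial.aeval_X, map_mul, map_sub, MvPolynomial.algHom_C, map_one, ev,
        MvPolynomial.aeval_X, q]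
  intro x y hxy
  rw [h, h] at hxy
  exact MvPolynomial.map_injective _ Polynomial.toLaurent_injective
    (sig_injective (ev_injective b hxy))

theorem phi_injective (b : Module.Basis ι ℤ X) : Function.Injective (phi X) := by
  rw [injective_iff_map_eq_zero]
  intro a ha
  obtain ⟨x, hx, r, hr⟩ := exists_mul b a
  have hr' : g b r = (1 + hh X * P x) * a := hr
  have h0 : (phi X).comp (g b) r = (phi X).comp (g b) 0 := by
    rw [AlgHom.comp_apply, hr', map_mul, ha, mul_zero, map_zero]
  have := comp_injective b h0
  rw [this, map_zero] at hr'
  have hu := u_add (-x) x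
  rw [neg_add_cancel, P_zero, mul_zero, add_zero] at hu
  calc a = ((1 + hh X * P (-x)) * (1 + hh X * P x)) * a := by rw [← hu, one_mul]
    _ = 0 := by rw [mul_assoc, ← hr', mul_zero]

end InterpAlg

/-- For a finitely generated free abelian group `X`, the unique
`ℤ[h]`-algebra homomorphism `φ : A^h → ℤ[h,h⁻¹][X]` with `φ(P_x) = h⁻¹(e^x − 1)` is
injective; hence `A^h` is isomorphic to the `ℤ[h]`-subalgebra of `ℤ[h,h⁻¹][X]` generated by
the elements `h⁻¹(e^x − 1)`. -/
theorem interpAlg_to_laurent_injective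
    (X : Type*) [AddCommGroup X] [Module.Free ℤ X] [Module.Finite ℤ X] :
    ∃ φ : InterpAlg X →ₐ[Polynomial ℤ] AddMonoidAlgebra (LaurentPolynomial ℤ) X,
      (∀ x : X, φ (InterpAlg.P x) =
          algebraMap (LaurentPolynomial ℤ) (AddMonoidAlgebra (LaurentPolynomial ℤ) X)
              (LaurentPolynomial.T (-1)) *
            (AddMonoidAlgebra.single x 1 - 1)) ∧
      Function.Injective φ ∧
      ∀ ψ : InterpAlg X →ₐ[Polynomial ℤ] AddMonoidAlgebra (LaurentPolynomial ℤ) X,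
        (∀ x : X, ψ (InterpAlg.P x) =
            algebraMap (LaurentPolynomial ℤ) (AddMonoidAlgebra (LaurentPolynomial ℤ) X)
                (LaurentPolynomial.T (-1)) *
              (AddMonoidAlgebra.single x 1 - 1)) → ψ = φ := by
  exact ⟨InterpAlg.phi X, InterpAlg.phi_P,
    InterpAlg.phi_injective (Module.Free.chooseBasis ℤ X),
    fun ψ h => InterpAlg.hom_ext _ _ fun x => (h x).trans (InterpAlg.phi_P x).symm⟩

end
end
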